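/- Let X and Y be independent nonnegative random variables, with X subexponentially distributed, and Y bounded (essentially bounded above) and not degenerate at 0. Then the product XY is subexponentially distributed. -/

import Mathlib

open MeasureTheory Filter ProbabilityTheory

/-- The tail `1 - F(x)` of a distribution `μ` on `ℝ`. -/
noncomputable def mtail (μ : Measure ℝ) (x : ℝ) : ℝ := (μ (Set.Ioi x)).toReal

/-- The convolution of `μ` and `ν`. -/
noncomputable def mconv (μ ν : Measure ℝ) : Measure ℝ :=
  (μ.prod ν).map (fun p => p.1 + p.2)

/-- `μ` is subexponential: positive tail and `(1 - F^{*2}(x))/(1 - F(x)) → 2`. -/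
def Subexp (μ : Measure ℝ) : Prop :=
  (∀ x, 0 < mtail μ x) ∧
  Tendsto (fun x => mtail (mconv μ μ) x / mtail μ x) atTop (nhds 2)

/-- The tail of `μ` is asymptotically insensitive to bounded shifts. -/
def LongTailed (μ : Measure ℝ) : Prop :=
  ∀ t, 0 ≤ t → ∀ ε, 0 < ε → ∀ᶠ x in atTop, mtail μ (x - t) ≤ (1 + ε) * mtail μ x

/-- Two independent copies that are both large contribute negligibly to the tail of their sum. -/
def SmallBothLarge (μ : Measure ℝ) : Prop :=
  ∀ ε, 0 < ε → ∃ A, 0 ≤ A ∧ ∀ᶠ x in atTop,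
    (μ.prod μ).real {p | x < p.1 + p.2 ∧ A < p.1 ∧ A < p.2} ≤ ε * mtail μ x

section Tail

variable {μ : Measure ℝ}

lemma measurableSet_bothLarge (x A : ℝ) :
    MeasurableSet {p : ℝ × ℝ | x < p.1 + p.2 ∧ A < p.1 ∧ A < p.2} :=
  (measurableSet_lt measurable_const (measurable_fst.add measurable_snd)).inter
    ((measurableSet_lt measurable_const measurable_fst).inter
      (measurableSet_lt measurable_const measurable_snd))

lemma mtail_nonneg (x : ℝ) : 0 ≤ mtail μ x := ENNReal.toReal_nonneg

lemma mtail_mconv_self (x : ℝ) :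
    mtail (mconv μ μ) x = (μ.prod μ).real {p | x < p.1 + p.2} := by
  rw [mtail, mconv, Measure.map_apply (by fun_prop) measurableSet_Ioi]
  rfl

lemma Subexp.eventually_le (h : Subexp μ) {ε : ℝ} (hε : 0 < ε) :
    ∀ᶠ x in atTop, mtail (mconv μ μ) x ≤ (2 + ε) * mtail μ x := by
  filter_upwards [h.2.eventually_le_const (u := 2 + ε) (by linarith)] with x hx
  exact (div_le_iff₀ (h.1 x)).1 hx

variable [IsProbabilityMeasure μ]

lemma ofReal_mtail (x : ℝ) : ENNReal.ofReal (mtail μ x) = μ (Set.Ioi x) :=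
  ENNReal.ofReal_toReal (measure_ne_top _ _)

lemma mtail_anti : Antitone (mtail μ) := fun _ _ h =>
  measureReal_mono (μ := μ) (Set.Ioi_subset_Ioi h)

lemma mtail_eq_one_sub_cdf (x : ℝ) : mtail μ x = 1 - cdf μ x := by
  rw [cdf_eq_real, ← probReal_compl_eq_one_sub measurableSet_Iic, Set.compl_Iic]
  rfl

lemma tendsto_mtail : Tendsto (mtail μ) atTop (nhds 0) := by
  have h := (tendsto_cdf_atTop μ).const_sub 1
  rw [sub_self] at h
  exact h.congr fun x => (mtail_eq_one_sub_cdf x).symm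

lemma real_Ioc {s t : ℝ} (h : s ≤ t) : μ.real (Set.Ioc s t) = mtail μ s - mtail μ t := by
  have := measureReal_union (μ := μ) (Set.Ioc_disjoint_Ioi_same (a := s) (b := t))
    measurableSet_Ioi
  rw [Set.Ioc_union_Ioi_eq_Ioi h] at this
  simp only [mtail]
  simp only [Measure.real] at this ⊢
  linarith

lemma real_Ici_zero (hμ : ∀ᵐ a ∂μ, 0 ≤ a) : μ.real (Set.Ici 0) = 1 := by
  have : μ (Set.Ici 0) = 1 := (prob_compl_eq_zero_iff measurableSet_Ici).1 hμ
  simp [Measure.real, this]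

lemma real_Icc_zero (hμ : ∀ᵐ a ∂μ, 0 ≤ a) {t : ℝ} (ht : 0 ≤ t) :
    μ.real (Set.Icc 0 t) = 1 - mtail μ t := by
  have hd : Disjoint (Set.Icc 0 t) (Set.Ioi t) :=
    Set.disjoint_left.2 fun a h h' => not_lt.2 h.2 h'
  have := measureReal_union (μ := μ) hd measurableSet_Ioi
  rw [Set.Icc_union_Ioi_eq_Ici ht, real_Ici_zero hμ] at this
  rw [mtail]
  simp only [Measure.real] at this ⊢
  linarith

lemma Subexp.longTailed (h : Subexp μ) (hμ : ∀ᵐ a ∂μ, 0 ≤ a) : LongTailed μ := by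
  intro t ht ε hε
  have hT := h.1 t
  set η := ε * mtail μ t / (2 + ε) with hη
  have hη0 : 0 < η := by positivity
  have hηeq : η * (2 + ε) = ε * mtail μ t := by rw [hη]; field_simp
  filter_upwards [h.eventually_le hη0, (tendsto_mtail (μ := μ)).eventually_le_const hη0,
    eventually_ge_atTop t] with x h₁ h₂ hx
  have hd₁ : Disjoint (Set.Icc 0 t ×ˢ Set.Ioi x) (Set.Ioc t x ×ˢ Set.Ioi (x - t)) :=
    Set.disjoint_left.2 fun p h h' => not_lt.2 h.1.2 h'.1.1
  have hd₂ : Disjoint (Set.Icc 0 t ×ˢ Set.Ioi x ∪ Set.Ioc t x ×ˢ Set.Ioi (x - t))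
      (Set.Ioi x ×ˢ Set.Ici 0) := by
    refine Set.disjoint_left.2 fun p h h' => not_lt.2 (?_ : p.1 ≤ x) h'.1
    rcases h with h | h
    · exact h.1.2.trans hx
    · exact h.1.2
  have hsub : (Set.Icc 0 t ×ˢ Set.Ioi x ∪ Set.Ioc t x ×ˢ Set.Ioi (x - t)) ∪
      Set.Ioi x ×ˢ Set.Ici 0 ⊆ {p : ℝ × ℝ | x < p.1 + p.2} := by
    rintro ⟨a, b⟩ h
    simp only [Set.mem_union, Set.mem_prod, Set.mem_Icc, Set.mem_Ioi, Set.mem_Ioc, Set.mem_Ici,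
      Set.mem_ofPred_eq] at h ⊢
    rcases h with (h | h) | h <;> linarith [h.1, h.2]
  have hle := measureReal_mono (μ := μ.prod μ) hsub
  rw [measureReal_union hd₂ (measurableSet_Ioi.prod measurableSet_Ici),
    measureReal_union hd₁ (measurableSet_Ioc.prod measurableSet_Ioi),
    measureReal_prod_prod, measureReal_prod_prod, measureReal_prod_prod,
    real_Ici_zero hμ, real_Icc_zero hμ ht, real_Ioc hx, ← mtail_mconv_self] at hle
  change (1 - mtail μ t) * mtail μ x + (mtail μ t - mtail μ x) * mtail μ (x - t) +
    mtail μ x * 1 ≤ _ at hle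
  have h₃ : (mtail μ t - η) * mtail μ (x - t) ≤ (mtail μ t + η) * mtail μ x := by
    nlinarith [mul_le_mul_of_nonneg_right h₂ (mtail_nonneg (μ := μ) (x - t))]
  have h₄ : (mtail μ t + η) = (1 + ε) * (mtail μ t - η) := by linarith
  have h₅ : 0 < mtail μ t - η := by
    by_contra! hc
    nlinarith
  rw [h₄] at h₃
  refine le_of_mul_le_mul_left (h₃.trans_eq ?_) h₅
  ring

lemma Subexp.smallBothLarge (h : Subexp μ) (hμ : ∀ᵐ a ∂μ, 0 ≤ a) : SmallBothLarge μ := by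
  intro ε hε
  obtain ⟨A, hA, hA0⟩ := ((tendsto_mtail (μ := μ)).eventually_le_const
    (u := ε / 4) (by linarith)).and (eventually_ge_atTop 0) |>.exists
  refine ⟨A, hA0, ?_⟩
  filter_upwards [h.eventually_le (half_pos hε), eventually_ge_atTop A] with x h₁ hx
  set S := {p : ℝ × ℝ | x < p.1 + p.2 ∧ A < p.1 ∧ A < p.2}
  have hd₁ : Disjoint S (Set.Icc 0 A ×ˢ Set.Ioi x) :=
    Set.disjoint_left.2 fun p h h' => not_lt.2 h'.1.2 h.2.1
  have hd₂ : Disjoint (S ∪ Set.Icc 0 A ×ˢ Set.Ioi x) (Set.Ioi x ×ˢ Set.Icc 0 A) := by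
    refine Set.disjoint_left.2 fun p h h' => ?_
    rcases h with h | h
    · exact not_lt.2 h'.2.2 h.2.2
    · exact not_lt.2 (h.1.2.trans hx) h'.1
  have hsub : (S ∪ Set.Icc 0 A ×ˢ Set.Ioi x) ∪ Set.Ioi x ×ˢ Set.Icc 0 A ⊆
      {p : ℝ × ℝ | x < p.1 + p.2} := by
    rintro ⟨a, b⟩ h
    simp only [S, Set.mem_union, Set.mem_prod, Set.mem_Icc, Set.mem_Ioi,
      Set.mem_ofPred_eq] at h ⊢
    rcases h with (h | h) | h <;> linarith [h.1, h.2]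
  have hle := measureReal_mono (μ := μ.prod μ) hsub
  rw [measureReal_union hd₂ (measurableSet_Ioi.prod measurableSet_Icc),
    measureReal_union hd₁ (measurableSet_Icc.prod measurableSet_Ioi),
    measureReal_prod_prod, measureReal_prod_prod,
    real_Icc_zero hμ hA0, ← mtail_mconv_self] at hle
  change _ + (1 - mtail μ A) * mtail μ x + mtail μ x * (1 - mtail μ A) ≤ _ at hle
  nlinarith [mul_le_mul_of_nonneg_right hA (mtail_nonneg (μ := μ) x)]

lemma subexp_of_longTailed_of_smallBothLarge (hμ : ∀ᵐ a ∂μ, 0 ≤ a)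
    (hpos : ∀ x, 0 < mtail μ x) (hL : LongTailed μ) (hS : SmallBothLarge μ) : Subexp μ := by
  refine ⟨hpos, ?_⟩
  have lower : ∀ᶠ x in atTop, 2 - mtail μ x ≤ mtail (mconv μ μ) x / mtail μ x := by
    filter_upwards [eventually_ge_atTop 0] with x hx
    rw [le_div_iff₀ (hpos x)]
    have hd : Disjoint (Set.Icc 0 x ×ˢ Set.Ioi x) (Set.Ioi x ×ˢ Set.Ici 0) :=
      Set.disjoint_left.2 fun p h h' => not_lt.2 h.1.2 h'.1
    have hsub : Set.Icc 0 x ×ˢ Set.Ioi x ∪ Set.Ioi x ×ˢ Set.Ici 0 ⊆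
        {p : ℝ × ℝ | x < p.1 + p.2} := by
      rintro ⟨a, b⟩ h
      simp only [Set.mem_union, Set.mem_prod, Set.mem_Icc, Set.mem_Ioi, Set.mem_Ici,
        Set.mem_ofPred_eq] at h ⊢
      rcases h with h | h <;> linarith [h.1, h.2]
    have hle := measureReal_mono (μ := μ.prod μ) hsub
    rw [measureReal_union hd (measurableSet_Ioi.prod measurableSet_Ici),
      measureReal_prod_prod, measureReal_prod_prod, real_Ici_zero hμ,
      real_Icc_zero hμ hx, ← mtail_mconv_self] at hle
    change (1 - mtail μ x) * mtail μ x + mtail μ x * 1 ≤ _ at hle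
    linarith
  have upper : ∀ ε, 0 < ε →
      ∀ᶠ x in atTop, mtail (mconv μ μ) x / mtail μ x ≤ 2 + 3 * ε := by
    intro ε hε
    obtain ⟨A, hA0, hA⟩ := hS ε hε
    filter_upwards [hA, hL A hA0 ε hε] with x h₁ h₂
    rw [div_le_iff₀ (hpos x), mtail_mconv_self]
    have hsub : {p : ℝ × ℝ | x < p.1 + p.2} ⊆
        {p | x < p.1 + p.2 ∧ A < p.1 ∧ A < p.2} ∪
          (Set.Ioi (x - A) ×ˢ Set.univ ∪ Set.univ ×ˢ Set.Ioi (x - A)) := by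
      rintro ⟨a, b⟩ h
      simp only [Set.mem_union, Set.mem_prod, Set.mem_Ioi, Set.mem_univ, and_true, true_and,
        Set.mem_ofPred_eq] at h ⊢
      by_cases ha : A < a
      · by_cases hb : A < b
        · exact Or.inl ⟨h, ha, hb⟩
        · right; left; linarith
      · right; right; linarith
    have h₃ := (measureReal_mono (μ := μ.prod μ) hsub).trans
      ((measureReal_union_le _ _).trans (add_le_add_right (measureReal_union_le _ _) _))
    rw [measureReal_prod_prod, measureReal_prod_prod, probReal_univ] at h₃
    change _ ≤ _ + (mtail μ (x - A) * 1 + 1 * mtail μ (x - A)) at h₃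
    linarith
  refine tendsto_order.2 ⟨fun a ha => ?_, fun b hb => ?_⟩
  · filter_upwards [lower, (tendsto_mtail (μ := μ)).eventually_lt_const (sub_pos.2 ha)] with x h₁ h₂
    linarith
  · filter_upwards [upper ((b - 2) / 6) (by linarith)] with x hx
    linarith

end Tail

section Product

variable {μ ν : Measure ℝ}

lemma exists_measure_Ioi_pos (hν0 : 0 < ν (Set.Ioi 0)) : ∃ c, 0 < c ∧ 0 < ν (Set.Ioi c) := by
  by_contra! h
  have hU : Set.Ioi (0 : ℝ) ⊆ ⋃ n : ℕ, Set.Ioi (1 / ((n : ℝ) + 1)) := by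
    intro b hb
    obtain ⟨n, hn⟩ := exists_nat_one_div_lt (Set.mem_Ioi.1 hb)
    exact Set.mem_iUnion.2 ⟨n, hn⟩
  refine hν0.ne' (measure_mono_null hU (measure_iUnion_null fun n => ?_))
  exact le_antisymm (h _ (by positivity)) bot_le

variable [IsProbabilityMeasure μ] [IsProbabilityMeasure ν]

lemma mconv_Ioi (x : ℝ) :
    Measure.mconv μ ν (Set.Ioi x) = ∫⁻ b, μ {a | x < a * b} ∂ν := by
  rw [Measure.mconv, Measure.map_apply (by fun_prop) measurableSet_Ioi,
    Measure.prod_apply_symm (measurableSet_Ioi.preimage (by fun_prop))]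
  rfl

lemma measurable_measure_mul_gt (x : ℝ) : Measurable fun b => μ {a | x < a * b} :=
  measurable_measure_prodMk_right (μ := μ) (s := {p : ℝ × ℝ | x < p.1 * p.2})
    (measurableSet_lt (by fun_prop) (by fun_prop))

lemma setOf_lt_mul_eq_Ioi (x : ℝ) {b : ℝ} (hb : 0 < b) :
    {a | x < a * b} = Set.Ioi (x / b) := by
  ext a
  simp [div_lt_iff₀ hb]

lemma mul_le_mconv_Ioi {x c : ℝ} (hx : 0 ≤ x) (hc : 0 < c) :
    μ (Set.Ioi (x / c)) * ν (Set.Ioi c) ≤ Measure.mconv μ ν (Set.Ioi x) := by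
  rw [mconv_Ioi, ← setLIntegral_const]
  refine (setLIntegral_mono (measurable_measure_mul_gt x) fun b hb => ?_).trans
    (setLIntegral_le_lintegral _ _)
  have hb : c < b := hb
  rw [setOf_lt_mul_eq_Ioi x (hc.trans hb)]
  exact measure_mono (Set.Ioi_subset_Ioi (by gcongr))

lemma exists_measure_Ioc_lt {c : ℝ} (hc : 0 < c) {η : ENNReal} (hη : 0 < η) :
    ∃ δ, 0 < δ ∧ δ < c ∧ ν (Set.Ioc 0 δ) < η := by
  have hlim : Tendsto (fun δ => ν (Set.Ioc 0 δ)) (nhdsWithin 0 (Set.Ioi 0))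
      (nhds (ν (⋂ δ > (0 : ℝ), Set.Ioc 0 δ))) :=
    tendsto_measure_biInter_gt (fun _ _ => measurableSet_Ioc.nullMeasurableSet)
      (fun _ _ _ h => Set.Ioc_subset_Ioc_right h) ⟨1, one_pos, measure_ne_top _ _⟩
  have hempty : (⋂ δ > (0 : ℝ), Set.Ioc 0 δ) = ∅ := by
    refine Set.eq_empty_of_forall_notMem fun b hb => ?_
    simp only [Set.mem_iInter, Set.mem_Ioc] at hb
    have h₁ := (hb 1 one_pos).1
    linarith [(hb (b / 2) (by linarith)).2]
  rw [hempty, measure_empty] at hlim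
  obtain ⟨δ, h₁, h₂⟩ := ((hlim.eventually_lt_const hη).and (Ioo_mem_nhdsGT hc)).exists
  exact ⟨δ, h₂.1, h₂.2, h₁⟩

lemma mtail_mconv_pos (hpos : ∀ x, 0 < mtail μ x) (hν0 : 0 < ν (Set.Ioi 0)) (x : ℝ) :
    0 < mtail (Measure.mconv μ ν) x := by
  obtain ⟨c, hc, hνc⟩ := exists_measure_Ioi_pos hν0
  refine lt_of_lt_of_le ?_ (mtail_anti (le_max_left x 0))
  refine ENNReal.toReal_pos (ne_of_gt ?_) (measure_ne_top _ _)
  refine lt_of_lt_of_le (ENNReal.mul_pos ?_ hνc.ne') (mul_le_mconv_Ioi (le_max_right x 0) hc)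
  rw [← ofReal_mtail]
  exact (ENNReal.ofReal_pos.2 (hpos _)).ne'

lemma longTailed_mconv (hμ : ∀ᵐ a ∂μ, 0 ≤ a) (hν0 : 0 < ν (Set.Ioi 0)) {M : ℝ} (hM : 0 < M)
    (hνM : ∀ᵐ b ∂ν, b ≤ M)
    (hL : LongTailed μ) : LongTailed (Measure.mconv μ ν) := by
  intro t ht ε hε
  obtain ⟨c, hc, hνc⟩ := exists_measure_Ioi_pos hν0
  have hε2 : 0 < ENNReal.ofReal (ε / 2) := ENNReal.ofReal_pos.2 (by linarith)
  obtain ⟨δ, hδ, hδc, hνδ⟩ := exists_measure_Ioc_lt (ν := ν) hc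
    (ENNReal.mul_pos hε2.ne' hνc.ne')
  obtain ⟨u, hu⟩ := eventually_atTop.1 (hL (t / δ) (by positivity) (ε / 2) (by linarith))
  filter_upwards [eventually_ge_atTop (M * u), eventually_gt_atTop t,
    eventually_ge_atTop (t * c / (c - δ))] with x hxu hxt hxc
  have hx0 : 0 ≤ x := ht.trans hxt.le
  have key : ∀ᵐ b ∂ν, μ {a | x - t < a * b} ≤ ENNReal.ofReal (1 + ε / 2) * μ {a | x < a * b} +
      (Set.Ioc 0 δ).indicator (fun _ => μ (Set.Ioi (x / c))) b := by
    filter_upwards [hνM] with b hbM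
    rcases le_or_gt b 0 with hb0 | hb0
    · have : μ {a | x - t < a * b} = 0 := by
        refine measure_mono_null (fun a ha => ?_) (ae_iff.1 hμ)
        have ha : x - t < a * b := ha
        intro h
        nlinarith [mul_nonneg h (neg_nonneg.2 hb0)]
      rw [this]
      exact zero_le
    rcases le_or_gt b δ with hbδ | hbδ
    · rw [Set.indicator_of_mem (show b ∈ Set.Ioc 0 δ from ⟨hb0, hbδ⟩)]
      refine le_trans ?_ le_add_self
      rw [setOf_lt_mul_eq_Ioi _ hb0]
      refine measure_mono (Set.Ioi_subset_Ioi ?_)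
      rw [div_le_div_iff₀ hc hb0]
      rw [div_le_iff₀ (by linarith)] at hxc
      nlinarith [mul_le_mul_of_nonneg_left hbδ hx0]
    · refine le_trans ?_ le_self_add
      rw [setOf_lt_mul_eq_Ioi _ hb0, setOf_lt_mul_eq_Ioi _ hb0, ← ofReal_mtail, ← ofReal_mtail,
        ← ENNReal.ofReal_mul (by linarith)]
      refine ENNReal.ofReal_le_ofReal (le_trans (mtail_anti ?_) (hu (x / b) ?_))
      · rw [sub_div]
        gcongr
      · rcases le_or_gt u 0 with h | h
        · exact h.trans (by positivity)
        · rw [le_div_iff₀ hb0]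
          nlinarith
  have h₁ : Measure.mconv μ ν (Set.Ioi (x - t)) ≤
      ENNReal.ofReal (1 + ε) * Measure.mconv μ ν (Set.Ioi x) := by
    calc Measure.mconv μ ν (Set.Ioi (x - t)) = ∫⁻ b, μ {a | x - t < a * b} ∂ν := mconv_Ioi _
      _ ≤ ∫⁻ b, (ENNReal.ofReal (1 + ε / 2) * μ {a | x < a * b} +
          (Set.Ioc 0 δ).indicator (fun _ => μ (Set.Ioi (x / c))) b) ∂ν := lintegral_mono_ae key
      _ = ENNReal.ofReal (1 + ε / 2) * Measure.mconv μ ν (Set.Ioi x) +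
          μ (Set.Ioi (x / c)) * ν (Set.Ioc 0 δ) := by
        rw [lintegral_add_left ((measurable_measure_mul_gt x).const_mul _),
          lintegral_const_mul _ (measurable_measure_mul_gt x), ← mconv_Ioi,
          lintegral_indicator_const measurableSet_Ioc]
      _ ≤ ENNReal.ofReal (1 + ε / 2) * Measure.mconv μ ν (Set.Ioi x) +
          ENNReal.ofReal (ε / 2) * Measure.mconv μ ν (Set.Ioi x) := by
        refine add_le_add le_rfl ?_
        calc μ (Set.Ioi (x / c)) * ν (Set.Ioc 0 δ)
            ≤ μ (Set.Ioi (x / c)) * (ENNReal.ofReal (ε / 2) * ν (Set.Ioi c)) := by gcongr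
          _ = ENNReal.ofReal (ε / 2) * (μ (Set.Ioi (x / c)) * ν (Set.Ioi c)) := by ring
          _ ≤ _ := by gcongr; exact mul_le_mconv_Ioi hx0 hc
      _ = _ := by
        rw [← add_mul, ← ENNReal.ofReal_add (by linarith) (by linarith)]
        ring_nf
  rw [← ofReal_mtail, ← ofReal_mtail, ← ENNReal.ofReal_mul (by linarith)] at h₁
  exact (ENNReal.ofReal_le_ofReal_iff (mul_nonneg (by linarith) (mtail_nonneg x))).1 h₁

lemma mconv_prod_mconv :
    (Measure.mconv μ ν).prod (Measure.mconv μ ν) = ((μ.prod μ).prod (ν.prod ν)).map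
      (fun q => (q.1.1 * q.2.1, q.1.2 * q.2.2)) := by
  have happ : ∀ s, MeasurableSet s →
      Measure.mconv μ ν s = ∫⁻ b, μ ((fun a => a * b) ⁻¹' s) ∂ν := by
    intro s hs
    rw [Measure.mconv, Measure.map_apply (by fun_prop) hs,
      Measure.prod_apply_symm (hs.preimage (by fun_prop))]
    rfl
  have hmeas : ∀ s, MeasurableSet s → Measurable fun b => μ ((fun a => a * b) ⁻¹' s) := by
    intro s hs
    exact measurable_measure_prodMk_right (μ := μ)
      (hs.preimage (by fun_prop : Measurable fun p : ℝ × ℝ => p.1 * p.2))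
  refine Measure.prod_eq fun s t hs ht => ?_
  rw [Measure.map_apply (by fun_prop) (hs.prod ht),
    Measure.prod_apply_symm ((hs.prod ht).preimage (by fun_prop)), happ s hs, happ t ht,
    ← lintegral_prod_mul (hmeas s hs).aemeasurable (hmeas t ht).aemeasurable]
  refine lintegral_congr fun b => ?_
  rw [← Measure.prod_prod]
  rfl

lemma smallBothLarge_mconv (hμ : ∀ᵐ a ∂μ, 0 ≤ a) {M : ℝ} (hM : 0 < M)
    (hν : ∀ᵐ b ∂ν, 0 ≤ b) (hνM : ∀ᵐ b ∂ν, b ≤ M)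
    (hS : SmallBothLarge μ) : SmallBothLarge (Measure.mconv μ ν) := by
  intro ε hε
  obtain ⟨A, hA0, hA⟩ := hS (ε / 2) (by linarith)
  obtain ⟨u, hu⟩ := eventually_atTop.1 hA
  refine ⟨M * A, by positivity, ?_⟩
  filter_upwards [eventually_ge_atTop (M * u), eventually_ge_atTop 0] with x hxu hx0
  have hb : ∀ᵐ b ∂ν, 0 ≤ b ∧ b ≤ M := hν.and hνM
  have both : ∀ m, 0 < m → m ≤ M →
      (μ.prod μ) {p | x / m < p.1 + p.2 ∧ A < p.1 ∧ A < p.2} ≤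
        ENNReal.ofReal (ε / 2) * μ {a | x < a * m} := by
    intro m hm hmM
    rw [setOf_lt_mul_eq_Ioi _ hm, ← ofReal_mtail, ← ENNReal.ofReal_mul (by linarith),
      ← ofReal_measureReal]
    refine ENNReal.ofReal_le_ofReal (hu (x / m) ?_)
    rcases le_or_gt u 0 with h | h
    · exact h.trans (by positivity)
    · rw [le_div_iff₀ hm]
      nlinarith
  have key : ∀ᵐ b ∂(ν.prod ν),
      (μ.prod μ) {p | x < p.1 * b.1 + p.2 * b.2 ∧ M * A < p.1 * b.1 ∧ M * A < p.2 * b.2} ≤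
        ENNReal.ofReal (ε / 2) * (μ {a | x < a * b.1} + μ {a | x < a * b.2}) := by
    have hpos : ∀ᵐ p ∂(μ.prod μ), 0 ≤ p.1 ∧ 0 ≤ p.2 :=
      (Measure.quasiMeasurePreserving_fst.ae hμ).and (Measure.quasiMeasurePreserving_snd.ae hμ)
    filter_upwards [Measure.quasiMeasurePreserving_fst.ae hb,
      Measure.quasiMeasurePreserving_snd.ae hb] with b hb₁ hb₂
    have hmM : max b.1 b.2 ≤ M := max_le hb₁.2 hb₂.2
    rcases (le_max_of_le_left hb₁.1 : 0 ≤ max b.1 b.2).eq_or_lt with hm | hm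
    · have h₁ : b.1 ≤ 0 := hm ▸ le_max_left b.1 b.2
      have : {p : ℝ × ℝ | x < p.1 * b.1 + p.2 * b.2 ∧ M * A < p.1 * b.1 ∧
          M * A < p.2 * b.2} = ∅ := by
        refine Set.eq_empty_of_forall_notMem fun p hp => ?_
        have h₂ := hp.2.1
        rw [le_antisymm h₁ hb₁.1, mul_zero] at h₂
        exact absurd h₂ (not_lt.2 (by positivity))
      rw [this, measure_empty]
      exact zero_le
    · calc _ ≤ (μ.prod μ) {p | x / max b.1 b.2 < p.1 + p.2 ∧ A < p.1 ∧ A < p.2} := by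
            refine measure_mono_ae ?_
            filter_upwards [hpos] with p hp0 hp
            obtain ⟨h₁, h₂, h₃⟩ := hp
            refine ⟨?_, ?_, ?_⟩
            · rw [div_lt_iff₀ hm]
              nlinarith [mul_le_mul_of_nonneg_left (le_max_left b.1 b.2) hp0.1,
                mul_le_mul_of_nonneg_left (le_max_right b.1 b.2) hp0.2]
            · have := mul_le_mul_of_nonneg_left hb₁.2 hp0.1
              exact lt_of_mul_lt_mul_left (by linarith) hM.le
            · have := mul_le_mul_of_nonneg_left hb₂.2 hp0.2
              exact lt_of_mul_lt_mul_left (by linarith) hM.le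
        _ ≤ ENNReal.ofReal (ε / 2) * μ {a | x < a * max b.1 b.2} := both _ hm hmM
        _ ≤ _ := by
            gcongr
            rcases max_choice b.1 b.2 with h | h <;> rw [h]
            · exact le_self_add
            · exact le_add_self
  have hm₁ : Measurable fun b : ℝ × ℝ => μ {a | x < a * b.1} :=
    (measurable_measure_mul_gt x).comp measurable_fst
  have hm₂ : Measurable fun b : ℝ × ℝ => μ {a | x < a * b.2} :=
    (measurable_measure_mul_gt x).comp measurable_snd
  have h₁ : ((Measure.mconv μ ν).prod (Measure.mconv μ ν))
      {p | x < p.1 + p.2 ∧ M * A < p.1 ∧ M * A < p.2} ≤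
        ENNReal.ofReal ε * Measure.mconv μ ν (Set.Ioi x) := by
    calc _ = ∫⁻ b, (μ.prod μ) {p | x < p.1 * b.1 + p.2 * b.2 ∧ M * A < p.1 * b.1 ∧
            M * A < p.2 * b.2} ∂(ν.prod ν) := by
          rw [mconv_prod_mconv, Measure.map_apply (by fun_prop) (measurableSet_bothLarge _ _),
            Measure.prod_apply_symm ((measurableSet_bothLarge _ _).preimage (by fun_prop))]
          rfl
      _ ≤ ∫⁻ b, ENNReal.ofReal (ε / 2) * (μ {a | x < a * b.1} + μ {a | x < a * b.2})
            ∂(ν.prod ν) := lintegral_mono_ae key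
      _ = ENNReal.ofReal (ε / 2) *
            (Measure.mconv μ ν (Set.Ioi x) + Measure.mconv μ ν (Set.Ioi x)) := by
          rw [lintegral_const_mul' _ _ ENNReal.ofReal_ne_top, lintegral_add_left hm₁, mconv_Ioi,
            measurePreserving_fst.lintegral_comp (measurable_measure_mul_gt x),
            measurePreserving_snd.lintegral_comp (measurable_measure_mul_gt x)]
      _ = _ := by
          rw [← two_mul, ← mul_assoc, ← ENNReal.ofReal_ofNat,
            ← ENNReal.ofReal_mul (by linarith)]
          ring_nf
  rw [← ofReal_measureReal, ← ofReal_mtail, ← ENNReal.ofReal_mul hε.le] at h₁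
  exact (ENNReal.ofReal_le_ofReal_iff (mul_nonneg hε.le (mtail_nonneg x))).1 h₁

end Product

/-- If `X` and `Y` are independent nonnegative random variables with `X` subexponential
and `Y` (essentially) bounded and not degenerate at `0`, then `XY` is subexponential. -/
theorem subexp_mul_bounded {Ω : Type*} [MeasurableSpace Ω] (P : Measure Ω)
    [IsProbabilityMeasure P] (X Y : Ω → ℝ)
    (hXm : Measurable X) (hYm : Measurable Y)
    (hindep : IndepFun X Y P)
    (hXpos : ∀ᵐ ω ∂P, 0 ≤ X ω) (hYpos : ∀ᵐ ω ∂P, 0 ≤ Y ω)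
    (hXsub : Subexp (P.map X))
    (hYbdd : ∃ M : ℝ, ∀ᵐ ω ∂P, Y ω ≤ M)
    (hYnd : 0 < P {ω | 0 < Y ω}) :
    Subexp (P.map (fun ω => X ω * Y ω)) := by
  have : IsProbabilityMeasure (P.map X) := Measure.isProbabilityMeasure_map hXm.aemeasurable
  have : IsProbabilityMeasure (P.map Y) := Measure.isProbabilityMeasure_map hYm.aemeasurable
  have hlaw : P.map (fun ω => X ω * Y ω) = Measure.mconv (P.map X) (P.map Y) := by
    rw [Measure.mconv, ← hindep.map_prod_eq_prod_map_map hXm.aemeasurable hYm.aemeasurable,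
      Measure.map_map (by fun_prop) (by fun_prop)]
    rfl
  have hμ : ∀ᵐ a ∂(P.map X), 0 ≤ a :=
    (ae_map_iff hXm.aemeasurable measurableSet_Ici).2 hXpos
  have hν : ∀ᵐ b ∂(P.map Y), 0 ≤ b :=
    (ae_map_iff hYm.aemeasurable measurableSet_Ici).2 hYpos
  have hXY : ∀ᵐ c ∂(P.map fun ω => X ω * Y ω), 0 ≤ c := by
    refine (ae_map_iff (hXm.mul hYm).aemeasurable measurableSet_Ici).2 ?_
    filter_upwards [hXpos, hYpos] with ω h₁ h₂ using mul_nonneg h₁ h₂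
  have hν0 : 0 < P.map Y (Set.Ioi 0) := by
    rwa [Measure.map_apply hYm measurableSet_Ioi]
  obtain ⟨M, hM⟩ := hYbdd
  have hνM : ∀ᵐ b ∂(P.map Y), b ≤ max M 1 := by
    refine (ae_map_iff hYm.aemeasurable measurableSet_Iic).2 ?_
    filter_upwards [hM] with ω h using h.trans (le_max_left _ _)
  have hM0 : 0 < max M 1 := lt_max_of_lt_right one_pos
  rw [hlaw] at hXY ⊢
  exact subexp_of_longTailed_of_smallBothLarge hXY
    (mtail_mconv_pos hXsub.1 hν0)
    (longTailed_mconv hμ hν0 hM0 hνM (hXsub.longTailed hμ))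
    (smallBothLarge_mconv hμ hM0 hν hνM (hXsub.smallBothLarge hμ))
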